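/- With the punishment profile τ constructed from ρ*, L, σ_{-i} and σ^∞_{-i}: for every player i, every strategy τ'_i of player i, and every state s ∈ S^∞ with i(s) = i such that L(s) ∈ {⊥, i} and τ'_i(s) ∈ A(s) ∖ A^∞(s), one has u_i(τ'_i, τ_{-i} | s) < u_i(τ | s). -/

import Mathlib

open MeasureTheory

/-- A multi-player perfect-information game with probabilistic transitions:
a set of players `N`, a state space `S` with initial state `init`, a controlling
player `ctrl s` and a nonempty finite action set `act s` for every state `s`, and
a transition probability measure `q s a` for every state `s` and action `a`.
The supports of the transition measures are mutually disjoint and every state is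
reachable from the initial state, so every state is reached from `init` via
exactly one finite history (states correspond bijectively to histories). -/
structure PGame (N S A : Type*) where
  init : S
  ctrl : S → N
  act : S → Finset A
  act_nonempty : ∀ s, (act s).Nonempty
  q : S → A → PMF S
  unique_pred : ∀ z s a s' a', a ∈ act s → a' ∈ act s' →
    z ∈ (q s a).support → z ∈ (q s' a').support → s = s' ∧ a = a'
  init_not_succ : ∀ s a, a ∈ act s → init ∉ (q s a).support
  reach : ∀ z, Relation.ReflTransGen (fun s t => ∃ a ∈ act s, t ∈ (q s a).support) init z

namespace PGame

variable {N S A : Type*} (G : PGame N S A)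

/-- A play: an infinite alternating sequence of states and actions, starting at the
initial state, choosing legal actions and moving to successor states. -/
def IsPlay (p : ℕ → S × A) : Prop :=
  (p 0).1 = G.init ∧
    ∀ m, (p m).2 ∈ G.act (p m).1 ∧ (p (m + 1)).1 ∈ (G.q (p m).1 (p m).2).support

/-- The set of plays of the game. -/
def Play : Type _ := { p : ℕ → S × A // G.IsPlay p }

/-- The set of plays carries the topology generated by the cylinder sets, i.e. the
topology induced by the product of the discrete topologies. -/
instance : TopologicalSpace G.Play :=
  letI : TopologicalSpace S := ⊥
  letI : TopologicalSpace A := ⊥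
  inferInstanceAs (TopologicalSpace { p : ℕ → S × A // G.IsPlay p })

/-- The Borel σ-algebra on plays. -/
instance : MeasurableSpace G.Play := borel G.Play

/-- A strategy of player `i`: a choice of a legal action in every state controlled
by `i`. -/
def Strat (i : N) : Type _ := { f : S → A // ∀ s, G.ctrl s = i → f s ∈ G.act s }

/-- A strategy profile. -/
def Profile : Type _ := ∀ i : N, G.Strat i

/-- The profile `σ` with player `i`'s strategy replaced by `τi`. -/
noncomputable def comb (i : N) (τi : G.Strat i) (σ : G.Profile) : G.Profile :=
  haveI := Classical.decEq N
  Function.update σ i τi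

/-- The action that profile `σ` plays in state `s`. -/
def playFun (σ : G.Profile) (s : S) : A := (σ (G.ctrl s)).1 s

/-- The cylinder set of plays agreeing with the play `p0` on the first `n`
coordinates. -/
def cylSet (p0 : G.Play) (n : ℕ) : Set G.Play := { p : G.Play | ∀ m < n, p.1 m = p0.1 m }

open Classical in
/-- `μ` is the family of Borel probability measures on plays induced by the strategy
profiles via the Ionescu–Tulcea construction applied to `q`; it is uniquely
characterized by the probabilities it assigns to the cylinder sets: actions are
chosen deterministically according to the profile and states are drawn from the
transition probabilities. -/
def IsInducedMeasure (μ : G.Profile → Measure G.Play) : Prop :=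
  (∀ σ, IsProbabilityMeasure (μ σ)) ∧
    ∀ (σ : G.Profile) (p0 : G.Play) (n : ℕ),
      μ σ (G.cylSet p0 n) =
        ∏ m ∈ Finset.range n,
          ((if (p0.1 m).2 = G.playFun σ (p0.1 m).1 then 1 else 0) *
            (if m + 1 < n then G.q (p0.1 m).1 (p0.1 m).2 ((p0.1 (m + 1)).1) else 1))

/-- Expected payoff of player `i` under the profile `σ`: the integral of `u i`
against the induced measure. -/
noncomputable def epay (μ : G.Profile → Measure G.Play) (u : N → G.Play → ℝ)
    (σ : G.Profile) (i : N) : ℝ :=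
  ∫ p, u i p ∂(μ σ)

/-- Nash equilibrium: no player can improve his expected payoff by a unilateral
deviation. -/
def IsNash (μ : G.Profile → Measure G.Play) (u : N → G.Play → ℝ) (σ : G.Profile) : Prop :=
  ∀ (i : N) (τi : G.Strat i), G.epay μ u (G.comb i τi σ) i ≤ G.epay μ u σ i

/-- Secure equilibrium: a Nash equilibrium such that no player `i` has a deviation
keeping his own expected payoff equal, making all opponents weakly worse off, and
making some opponent strictly worse off. -/
def IsSecure (μ : G.Profile → Measure G.Play) (u : N → G.Play → ℝ) (σ : G.Profile) : Prop :=
  G.IsNash μ u σ ∧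
    ¬ ∃ (i : N) (τi : G.Strat i),
        G.epay μ u (G.comb i τi σ) i = G.epay μ u σ i ∧
        (∀ j : N, j ≠ i → G.epay μ u (G.comb i τi σ) j ≤ G.epay μ u σ j) ∧
        (∃ k : N, k ≠ i ∧ G.epay μ u (G.comb i τi σ) k < G.epay μ u σ k)

/-- One-step successor relation between states. -/
def step (s t : S) : Prop := ∃ a ∈ G.act s, t ∈ (G.q s a).support

/-- The set of plays that pass through the state `s` (i.e. the plays extending the
unique history from the initial state to `s`). -/
def through (s : S) : Set G.Play := { p : G.Play | ∃ n, (p.1 n).1 = s }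

/-- `E` is the family of subgame expected payoffs: `E σ s i` is the expected payoff
`u_i(σ|s)` of player `i` in the subgame `G(s)` starting from state `s`, under the
profile `σ`.  It is characterized as follows: `E σ s i` only depends on the actions
of `σ` in the subtree rooted at `s`, and for any profile `τ` agreeing with `σ`
there, the integral of `u_i` over the set of plays through `s` under the measure
induced by `τ` equals `E σ s i` times the probability of reaching `s` under `τ`. -/
def IsSubgamePayoff (μ : G.Profile → Measure G.Play) (u : N → G.Play → ℝ)
    (E : G.Profile → S → N → ℝ) : Prop :=
  ∀ (σ τ : G.Profile) (s : S) (i : N),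
    (∀ z, Relation.ReflTransGen G.step s z → G.playFun τ z = G.playFun σ z) →
    ∫ p in G.through s, u i p ∂(μ τ) = E σ s i * (μ τ (G.through s)).toReal
/-- One-step successor relation using only actions in the restricted action sets
`B`. -/
def stepIn (B : S → Set A) (s t : S) : Prop := ∃ a ∈ B s, t ∈ (G.q s a).support

/-- The value `v_i(s)` for player `i` of the zero-sum subgame from `s` of the game
restricted to the action sets `B`: player `i` maximizes the expectation of `u_i`
over his strategies playing in `B` (on the states reachable from `s` via
`B`-actions), while the coalition of his opponents jointly minimizes it over their
strategies playing in `B` there. -/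
noncomputable def rval (E : G.Profile → S → N → ℝ) (B : S → Set A) (s : S) (i : N) : ℝ :=
  ⨆ τi : { f : G.Strat i //
      ∀ z, Relation.ReflTransGen (G.stepIn B) s z → G.ctrl z = i → f.1 z ∈ B z },
    ⨅ τo : { g : G.Profile //
      ∀ z, Relation.ReflTransGen (G.stepIn B) s z → G.ctrl z ≠ i → G.playFun g z ∈ B z },
      E (G.comb i τi.1 τo.1) s i

/-- `v_i(s,a) = ∑_{z ∈ S(s,a)} q(s,a)(z) · v_i(z)` in the game restricted to the
action sets `B`. -/
noncomputable def rvalQ (E : G.Profile → S → N → ℝ) (B : S → Set A)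
    (s : S) (a : A) (i : N) : ℝ :=
  ∑' z : S, ((G.q s a) z).toReal * G.rval E B z i

/-- The elimination procedure: `Ak E 0 = A`, and `Ak E (k+1) s` consists of the
actions of `Ak E k s` that are optimal for the controlling player in the game
`G^k` restricted to the action sets `Ak E k`, i.e. such that
`v^k_{i(s)}(s,a) = v^k_{i(s)}(s)`. -/
noncomputable def Ak (E : G.Profile → S → N → ℝ) (k : ℕ) : S → Set A :=
  Nat.rec (motive := fun _ => S → Set A)
    (fun s => (G.act s : Set A))
    (fun _ B s =>
      { a ∈ B s | G.rvalQ E B s a (G.ctrl s) = G.rval E B s (G.ctrl s) })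
    k

/-- `Sk E k` is the state space `S^k` of the game `G^k`: the set of states
reachable from the initial state using only actions in the sets `Ak E k`. -/
def Sk (E : G.Profile → S → N → ℝ) (k : ℕ) : Set S :=
  { z | Relation.ReflTransGen (G.stepIn (G.Ak E k)) G.init z }

/-- `S^∞ = ⋂_k S^k`. -/
def Sinf (E : G.Profile → S → N → ℝ) : Set S := ⋂ k, G.Sk E k

/-- `A^∞(s) = ⋂_k A^k(s)`. -/
def Ainf (E : G.Profile → S → N → ℝ) (s : S) : Set A := ⋂ k, G.Ak E k s
end PGame

namespace PGame

section PMFfacts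

variable {S : Type*}

lemma aux_summable (q : PMF S) (f : S → ℝ) (C : ℝ) (hf : ∀ z, |f z| ≤ C) :
    Summable (fun z => (q z).toReal * f z) := by
  have h1 : Summable (fun z => (q z).toReal) := ENNReal.summable_toReal q.tsum_coe_ne_top
  refine Summable.of_norm_bounded (g := fun z => (q z).toReal * C) (h1.mul_right C) ?_
  intro z
  rw [Real.norm_eq_abs, abs_mul, abs_of_nonneg ENNReal.toReal_nonneg]
  exact mul_le_mul_of_nonneg_left (hf z) ENNReal.toReal_nonneg

lemma aux_tsum_one (q : PMF S) : ∑' z, (q z).toReal = 1 := by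
  rw [← ENNReal.tsum_toReal_eq (fun z => q.apply_ne_top z), q.tsum_coe]; simp

lemma aux_tsum_const (q : PMF S) (c : ℝ) : ∑' z, (q z).toReal * c = c := by
  rw [tsum_mul_right, aux_tsum_one, one_mul]

lemma aux_mono (q : PMF S) (f g : S → ℝ) (C D : ℝ) (hf : ∀ z, |f z| ≤ C)
    (hg : ∀ z, |g z| ≤ D) (ε : ℝ) (h : ∀ z ∈ q.support, f z ≤ g z + ε) :
    ∑' z, (q z).toReal * f z ≤ ∑' z, (q z).toReal * g z + ε := by
  have h1 : Summable (fun z => (q z).toReal) := ENNReal.summable_toReal q.tsum_coe_ne_top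
  rw [← aux_tsum_const q ε, ← (aux_summable q g D hg).tsum_add (h1.mul_right ε)]
  refine (aux_summable q f C hf).tsum_le_tsum ?_ ((aux_summable q g D hg).add (h1.mul_right ε))
  intro z
  by_cases hz : z ∈ q.support
  · rw [← mul_add]
    exact mul_le_mul_of_nonneg_left (h z hz) ENNReal.toReal_nonneg
  · rw [PMF.mem_support_iff, not_not] at hz
    simp [hz]

lemma aux_exists_le (q : PMF S) (f : S → ℝ) (C : ℝ) (hf : ∀ z, |f z| ≤ C) (c : ℝ)
    (h : ∑' z, (q z).toReal * f z ≤ c) : ∃ z ∈ q.support, f z ≤ c := by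
  by_contra! hcon
  obtain ⟨z0, hz0⟩ := q.support_nonempty
  have h1 : Summable (fun z => (q z).toReal) := ENNReal.summable_toReal q.tsum_coe_ne_top
  have : ∑' z, (q z).toReal * c < ∑' z, (q z).toReal * f z := by
    refine Summable.tsum_lt_tsum (i := z0) ?_ ?_ (h1.mul_right c) (aux_summable q f C hf)
    · intro z
      by_cases hz : z ∈ q.support
      · exact mul_le_mul_of_nonneg_left (hcon z hz).le ENNReal.toReal_nonneg
      · rw [PMF.mem_support_iff, not_not] at hz
        simp [hz]
    · exact mul_lt_mul_of_pos_left (hcon z0 hz0)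
        (ENNReal.toReal_pos hz0 (q.apply_ne_top z0))
  rw [aux_tsum_const] at this
  linarith

end PMFfacts

section Tree

variable {N S A : Type*} (G : PGame N S A)

/-- A profile from a legal action function. -/
def ofFun (f : S → A) (hf : ∀ s, f s ∈ G.act s) : G.Profile := fun _ => ⟨f, fun s _ => hf s⟩

lemma playFun_mem (σ : G.Profile) (s : S) : G.playFun σ s ∈ G.act s := (σ (G.ctrl s)).2 s rfl

lemma playFun_comb_self (i : N) (τi : G.Strat i) (σ : G.Profile) (s : S) (h : G.ctrl s = i) :
    G.playFun (G.comb i τi σ) s = τi.1 s := by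
  subst h
  classical
  unfold playFun comb
  exact congrArg (fun x : G.Strat (G.ctrl s) => x.1 s)
    (@Function.update_self N G.Strat (Classical.decEq N) (G.ctrl s) τi σ)

lemma playFun_comb_ne (i : N) (τi : G.Strat i) (σ : G.Profile) (s : S) (h : G.ctrl s ≠ i) :
    G.playFun (G.comb i τi σ) s = G.playFun σ s := by
  unfold playFun comb
  exact congrArg (fun x : G.Strat (G.ctrl s) => x.1 s)
    (@Function.update_of_ne N G.Strat (Classical.decEq N) (G.ctrl s) i h τi σ)

lemma play_unique (p p' : G.Play) : ∀ n n', (p.1 n).1 = (p'.1 n').1 →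
    n = n' ∧ ∀ m < n, p.1 m = p'.1 m := by
  intro n
  induction n with
  | zero =>
    intro n' h
    cases n' with
    | zero => exact ⟨rfl, by simp⟩
    | succ k =>
      exfalso
      rw [p.2.1] at h
      exact G.init_not_succ _ _ (p'.2.2 k).1 (h ▸ (p'.2.2 k).2)
  | succ n ih =>
    intro n' h
    cases n' with
    | zero =>
      exfalso
      rw [p'.2.1] at h
      exact G.init_not_succ _ _ (p.2.2 n).1 (h ▸ (p.2.2 n).2)
    | succ k =>
      obtain ⟨h1, h2⟩ := G.unique_pred _ _ _ _ _ (p.2.2 n).1 (p'.2.2 k).1 (p.2.2 n).2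
        (h ▸ (p'.2.2 k).2)
      obtain ⟨rfl, h3⟩ := ih k h1
      refine ⟨rfl, fun m hm => ?_⟩
      rcases Nat.lt_succ_iff_lt_or_eq.1 hm with h | rfl
      · exact h3 m h
      · exact Prod.ext h1 h2

/-- predecessor along a play -/
lemma play_pred (p : G.Play) (m : ℕ) (s : S) (a : A) (ha : a ∈ G.act s)
    (h : (p.1 m).1 ∈ (G.q s a).support) : ∃ k, m = k + 1 ∧ p.1 k = (s, a) := by
  cases m with
  | zero => exact absurd (p.2.1 ▸ h) (G.init_not_succ s a ha)
  | succ k =>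
    obtain ⟨h1, h2⟩ := G.unique_pred _ _ _ _ _ (p.2.2 k).1 ha (p.2.2 k).2 h
    exact ⟨k, rfl, Prod.ext h1 h2⟩

lemma play_ancestor {s z : S} (h : Relation.ReflTransGen G.step s z) (p : G.Play) :
    ∀ m, (p.1 m).1 = z → ∃ n ≤ m, (p.1 n).1 = s := by
  induction h with
  | refl => exact fun m hm => ⟨m, le_rfl, hm⟩
  | tail _ hbc ih =>
    intro m hm
    obtain ⟨a, ha, hz⟩ := hbc
    obtain ⟨k, rfl, hk⟩ := G.play_pred p m _ a ha (hm ▸ hz)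
    obtain ⟨n, hn, hn'⟩ := ih k (by rw [hk])
    exact ⟨n, by omega, hn'⟩

def Legal (t : ℕ → S × A) : Prop :=
  ∀ m, (t m).2 ∈ G.act (t m).1 ∧ (t (m + 1)).1 ∈ (G.q (t m).1 (t m).2).support

lemma exists_play_tail (s : S) : ∀ t : ℕ → S × A, (t 0).1 = s → G.Legal t →
    ∃ (n : ℕ) (p : G.Play), ∀ m, p.1 (n + m) = t m := by
  induction G.reach s with
  | refl => exact fun t h0 ht => ⟨0, ⟨t, h0, ht⟩, fun m => by simp⟩
  | @tail b c _ hbc ih =>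
    intro t h0 ht
    obtain ⟨a, ha, hz⟩ := hbc
    obtain ⟨n, p, hp⟩ := ih (fun m => Nat.casesOn m (b, a) t) rfl (by
      intro m
      cases m with
      | zero => exact ⟨ha, h0 ▸ hz⟩
      | succ k => exact ht k)
    refine ⟨n + 1, p, fun m => ?_⟩
    have := hp (m + 1)
    rw [show n + 1 + m = n + (m + 1) by omega]
    exact this

lemma legal_iter (f : S → A) (nx : S → S) (hf : ∀ s, f s ∈ G.act s)
    (hnx : ∀ s, nx s ∈ (G.q s (f s)).support) (s : S) :
    G.Legal (fun m => (nx^[m] s, f (nx^[m] s))) := by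
  intro m
  refine ⟨hf _, ?_⟩
  simp only [Function.iterate_succ_apply']
  exact hnx _

lemma exists_legal (f : S → A) (hf : ∀ s, f s ∈ G.act s) (s : S) :
    ∃ t : ℕ → S × A, t 0 = (s, f s) ∧ G.Legal t := by
  choose nx hnx using fun s => (G.q s (f s)).support_nonempty
  exact ⟨_, rfl, G.legal_iter f nx hf hnx s⟩

lemma exists_play_at (s : S) (a : A) (ha : a ∈ G.act s) :
    ∃ (n : ℕ) (p : G.Play), p.1 n = (s, a) := by
  classical
  choose b hb using G.act_nonempty
  obtain ⟨t, h0, ht⟩ := G.exists_legal (Function.update b s a) (by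
    intro z
    by_cases h : z = s
    · subst h; simpa using ha
    · rw [Function.update_of_ne h]; exact hb z) s
  obtain ⟨n, p, hp⟩ := G.exists_play_tail s t (by rw [h0]) ht
  refine ⟨n, p, ?_⟩
  have := hp 0
  rw [h0] at this
  simpa using this

/-- A child of `s`. -/
lemma child_unique {s z z' w : S} (hz : G.step s z) (hz' : G.step s z')
    (h : Relation.ReflTransGen G.step z w) (h' : Relation.ReflTransGen G.step z' w) : z = z' := by
  obtain ⟨b, hb⟩ := G.act_nonempty w
  obtain ⟨m, p, hp⟩ := G.exists_play_at w b hb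
  obtain ⟨n, -, hn⟩ := G.play_ancestor h p m (by rw [hp])
  obtain ⟨n', -, hn'⟩ := G.play_ancestor h' p m (by rw [hp])
  obtain ⟨a, ha, hs⟩ := hz
  obtain ⟨a', ha', hs'⟩ := hz'
  obtain ⟨k, rfl, hk⟩ := G.play_pred p n s a ha (hn ▸ hs)
  obtain ⟨k', rfl, hk'⟩ := G.play_pred p n' s a' ha' (hn' ▸ hs')
  obtain ⟨rfl, -⟩ := G.play_unique p p k k' (by rw [hk, hk'])
  exact hn.symm.trans hn'

lemma not_child_reach {s z : S} (hz : G.step s z) : ¬ Relation.ReflTransGen G.step z s := by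
  intro h
  obtain ⟨b, hb⟩ := G.act_nonempty s
  obtain ⟨m, p, hp⟩ := G.exists_play_at s b hb
  obtain ⟨n, hnm, hn⟩ := G.play_ancestor h p m (by rw [hp])
  obtain ⟨a, ha, hs⟩ := hz
  obtain ⟨k, rfl, hk⟩ := G.play_pred p n s a ha (hn ▸ hs)
  obtain ⟨rfl, -⟩ := G.play_unique p p k m (by rw [hk, hp])
  omega

lemma exists_paste (s : S) (a : A) (ha : a ∈ G.act s) (F : S → S → A)
    (hF : ∀ z w, F z w ∈ G.act w) :
    ∃ f : S → A, (∀ w, f w ∈ G.act w) ∧ f s = a ∧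
      ∀ z, G.step s z → ∀ w, Relation.ReflTransGen G.step z w → f w = F z w := by
  classical
  refine ⟨fun w => if w = s then (if w = s then a else F s w) else
    if h : ∃ z, G.step s z ∧ Relation.ReflTransGen G.step z w then F h.choose w else F s w,
    ?_, by simp, ?_⟩
  · intro w
    by_cases h : w = s
    · subst h; simpa using ha
    · simp only [h, if_false]
      split_ifs
      · exact hF _ _
      · exact hF _ _
  · intro z hz w hw
    have hne : w ≠ s := by
      rintro rfl
      exact G.not_child_reach hz hw
    have hex : ∃ z, G.step s z ∧ Relation.ReflTransGen G.step z w := ⟨z, hz, hw⟩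
    simp only [hne, if_false, dif_pos hex]
    rw [G.child_unique hex.choose_spec.1 hz hex.choose_spec.2 hw]

/-- A profile agreeing with `σ` on the subtree of `s` and following `p0` before. -/
lemma exists_reaching (σ : G.Profile) (p0 : G.Play) (n : ℕ) :
    ∃ σ' : G.Profile, (∀ z, Relation.ReflTransGen G.step (p0.1 n).1 z →
        G.playFun σ' z = G.playFun σ z) ∧ ∀ m < n, G.playFun σ' (p0.1 m).1 = (p0.1 m).2 := by
  classical
  refine ⟨G.ofFun (fun z => if h : ∃ m < n, (p0.1 m).1 = z then (p0.1 h.choose).2 else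
    G.playFun σ z) ?_, ?_, ?_⟩
  · intro z
    split_ifs with h
    · have := (p0.2.2 h.choose).1
      rwa [h.choose_spec.2] at this
    · exact G.playFun_mem σ z
  · intro z hz
    have : ¬ ∃ m < n, (p0.1 m).1 = z := by
      rintro ⟨m, hm, hmz⟩
      obtain ⟨k, hk, hk'⟩ := G.play_ancestor hz p0 m hmz
      have := (G.play_unique p0 p0 k n hk').1
      omega
    simp [ofFun, playFun, this]
  · intro m hm
    have hex : ∃ m' < n, (p0.1 m').1 = (p0.1 m).1 := ⟨m, hm, rfl⟩
    have := (G.play_unique p0 p0 _ m hex.choose_spec.2).1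
    simp only [ofFun, playFun, dif_pos hex]
    rw [this]

end Tree

section Meas

variable {N S A : Type*} (G : PGame N S A)

instance aux_borel : BorelSpace G.Play := ⟨rfl⟩

lemma isOpen_coord (n : ℕ) (T : Set (S × A)) : IsOpen {p : G.Play | p.1 n ∈ T} := by
  let _ : TopologicalSpace S := ⊥
  let _ : TopologicalSpace A := ⊥
  have : DiscreteTopology S := ⟨rfl⟩
  have : DiscreteTopology A := ⟨rfl⟩
  have hc : Continuous (fun p : { p : ℕ → S × A // G.IsPlay p } => p.1 n) :=
    (continuous_apply n).comp continuous_subtype_val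
  exact (isOpen_discrete T).preimage hc

lemma exists_cyl_subset (p : G.Play) (U : Set G.Play) (hU : IsOpen U) (hp : p ∈ U) :
    ∃ n, G.cylSet p n ⊆ U := by
  let _ : TopologicalSpace S := ⊥
  let _ : TopologicalSpace A := ⊥
  have : DiscreteTopology S := ⟨rfl⟩
  have : DiscreteTopology A := ⟨rfl⟩
  obtain ⟨V, hV, hVU⟩ : ∃ V : Set (ℕ → S × A), IsOpen V ∧ Subtype.val ⁻¹' V = U :=
    isOpen_induced_iff.1 hU
  subst hVU
  obtain ⟨v, ⟨y, n, rfl⟩, h'x, h's⟩ :=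
    (PiNat.isTopologicalBasis_cylinders (fun _ : ℕ => S × A)).exists_subset_of_mem_open hp hV
  rw [← PiNat.mem_cylinder_iff_eq.1 h'x] at h's
  exact ⟨n, fun p' hp' => h's hp'⟩

def takes (s : S) (a : A) : Set G.Play := {p | ∃ n, p.1 n = (s, a)}

lemma measurable_takes (s : S) (a : A) : MeasurableSet (G.takes s a) := by
  have : G.takes s a = ⋃ n, {p : G.Play | p.1 n ∈ ({(s, a)} : Set (S × A))} := by
    ext p; simp [takes]
  rw [this]
  exact (isOpen_iUnion fun n => G.isOpen_coord n _).measurableSet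

lemma measurable_through (s : S) : MeasurableSet (G.through s) := by
  have : G.through s = ⋃ n, {p : G.Play | p.1 n ∈ {x : S × A | x.1 = s}} := by
    ext p; simp [through]
  rw [this]
  exact (isOpen_iUnion fun n => G.isOpen_coord n _).measurableSet

lemma takes_eq_cyl (p0 : G.Play) (n : ℕ) :
    G.takes (p0.1 n).1 (p0.1 n).2 = G.cylSet p0 (n + 1) := by
  ext p
  constructor
  · rintro ⟨m, hm⟩
    obtain ⟨rfl, h⟩ := G.play_unique p p0 m n (by rw [hm])
    intro k hk
    rcases Nat.lt_succ_iff_lt_or_eq.1 hk with h' | rfl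
    · exact h k h'
    · exact hm
  · intro h
    exact ⟨n, h n (by omega)⟩



end Meas
end PGame
namespace PGame

section Meas2

variable {N S A : Type*} {G : PGame N S A} {μ : G.Profile → Measure G.Play}

lemma takes_null (hμ : G.IsInducedMeasure μ) (σ : G.Profile) (s : S) (a : A)
    (ha : a ∈ G.act s) (hne : a ≠ G.playFun σ s) : μ σ (G.takes s a) = 0 := by
  obtain ⟨n, p, hp⟩ := G.exists_play_at s a ha
  have h := G.takes_eq_cyl p n
  rw [hp] at h
  simp only at h
  rw [h, hμ.2]
  refine Finset.prod_eq_zero (i := n) (by simp) ?_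
  rw [hp]
  simp [hne]

lemma through_ae_takes (hμ : G.IsInducedMeasure μ) (σ : G.Profile) (s : S) :
    (G.through s : Set G.Play) =ᵐ[μ σ] G.takes s (G.playFun σ s) := by
  have hsub : G.takes s (G.playFun σ s) ⊆ G.through s := by
    rintro p ⟨n, hn⟩
    exact ⟨n, by rw [hn]⟩
  have hnull : μ σ (G.through s \ G.takes s (G.playFun σ s)) = 0 := by
    refine measure_mono_null (t := ⋃ a ∈ {a | a ∈ G.act s ∧ a ≠ G.playFun σ s}, G.takes s a) ?_ ?_
    · rintro p ⟨⟨n, hn⟩, hp⟩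
      simp only [Set.mem_iUnion]
      refine ⟨(p.1 n).2, ⟨hn ▸ (p.2.2 n).1, fun h => hp ⟨n, Prod.ext hn h⟩⟩, n, Prod.ext hn rfl⟩
    · rw [measure_biUnion_null_iff]
      · exact fun a ha => takes_null hμ σ s a ha.1 ha.2
      · exact ((G.act s).finite_toSet.subset (fun a ha => ha.1)).countable
  exact (ae_le_set.2 hnull).antisymm (LE.le.eventuallyLE hsub)

lemma measure_through (hμ : G.IsInducedMeasure μ) (σ : G.Profile) (p0 : G.Play) (n : ℕ) :
    μ σ (G.through (p0.1 n).1) =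
      ∏ m ∈ Finset.range n, ((open Classical in
        if (p0.1 m).2 = G.playFun σ (p0.1 m).1 then 1 else 0) *
        G.q (p0.1 m).1 (p0.1 m).2 ((p0.1 (m + 1)).1)) := by
  classical
  obtain ⟨t, h0, ht⟩ := G.exists_legal (G.playFun σ) (G.playFun_mem σ) (p0.1 n).1
  obtain ⟨k, p, hp⟩ := G.exists_play_tail _ t (by rw [h0]) ht
  have hk : p.1 k = ((p0.1 n).1, G.playFun σ (p0.1 n).1) := by
    rw [← h0, ← hp 0]; simp
  obtain ⟨rfl, hpre⟩ := G.play_unique p p0 k n (by rw [hk])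
  rw [measure_congr (through_ae_takes hμ σ _)]
  have h := G.takes_eq_cyl p k
  rw [hk] at h
  simp only at h
  rw [h, hμ.2, Finset.prod_range_succ, hk]
  simp only [lt_self_iff_false, if_false, if_true, mul_one]
  refine Finset.prod_congr rfl fun m hm => ?_
  have hm' := Finset.mem_range.1 hm
  have e2 : (p.1 (m + 1)).1 = (p0.1 (m + 1)).1 := by
    rcases Nat.lt_or_ge (m + 1) k with h | h
    · rw [hpre _ h]
    · have : m + 1 = k := by omega
      rw [this, hk]
  rw [if_pos (show m + 1 < k + 1 by omega), hpre m hm', e2]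

lemma measure_through_succ (hμ : G.IsInducedMeasure μ) (σ : G.Profile) (s z : S)
    (hz : z ∈ (G.q s (G.playFun σ s)).support) :
    μ σ (G.through z) = μ σ (G.through s) * G.q s (G.playFun σ s) z := by
  classical
  obtain ⟨t, h0, ht⟩ := G.exists_legal (G.playFun σ) (G.playFun_mem σ) z
  obtain ⟨n, p, hp⟩ := G.exists_play_tail z t (by rw [h0]) ht
  have h1 : (p.1 n).1 = z := by
    have := hp 0
    rw [Nat.add_zero, h0] at this
    rw [this]
  obtain ⟨k, rfl, hk⟩ := G.play_pred p n s _ (G.playFun_mem σ s) (h1 ▸ hz)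
  have e1 := measure_through hμ σ p (k + 1)
  have e2 := measure_through hμ σ p k
  rw [h1] at e1
  rw [hk] at e2
  simp only at e2
  rw [e1, e2, Finset.prod_range_succ, hk, h1]
  simp

lemma exists_reach_pos (hμ : G.IsInducedMeasure μ) (σ : G.Profile) (s : S) :
    ∃ σ' : G.Profile, (∀ z, Relation.ReflTransGen G.step s z →
        G.playFun σ' z = G.playFun σ z) ∧ μ σ' (G.through s) ≠ 0 := by
  classical
  obtain ⟨b, hb⟩ := G.act_nonempty s
  obtain ⟨n, p, hp⟩ := G.exists_play_at s b hb
  obtain ⟨σ', h1, h2⟩ := G.exists_reaching σ p n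
  rw [hp] at h1
  refine ⟨σ', h1, ?_⟩
  have := measure_through hμ σ' p n
  rw [hp] at this
  simp only at this
  rw [this, Finset.prod_ne_zero_iff]
  intro m hm
  rw [if_pos (h2 m (Finset.mem_range.1 hm)).symm, one_mul]
  exact (p.2.2 m).2

end Meas2

section Pay

variable {N S A : Type*} {G : PGame N S A} {μ : G.Profile → Measure G.Play}
  {u : N → G.Play → ℝ} {E : G.Profile → S → N → ℝ}

/-- locality -/
lemma E_local (hμ : G.IsInducedMeasure μ) (hE : G.IsSubgamePayoff μ u E)
    (σ σ' : G.Profile) (s : S) (i : N)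
    (h : ∀ z, Relation.ReflTransGen G.step s z → G.playFun σ z = G.playFun σ' z) :
    E σ s i = E σ' s i := by
  have := hμ.1
  obtain ⟨ρ, h1, h2⟩ := exists_reach_pos hμ σ s
  have e1 := hE σ ρ s i h1
  have e2 := hE σ' ρ s i (fun z hz => (h1 z hz).trans (h z hz))
  have hpos : (μ ρ (G.through s)).toReal ≠ 0 :=
    (ENNReal.toReal_pos h2 (measure_ne_top _ _)).ne'
  exact mul_right_cancel₀ hpos (e1.symm.trans e2)

lemma u_integrable (hμ : G.IsInducedMeasure μ) (σ : G.Profile) (i : N) (C : ℝ)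
    (hC : ∀ p, |u i p| ≤ C) (hc : Continuous (u i)) : Integrable (u i) (μ σ) := by
  have := hμ.1 σ
  exact Integrable.of_bound hc.measurable.aestronglyMeasurable C (Filter.Eventually.of_forall hC)

/-- local bounds -/
lemma E_bound (hμ : G.IsInducedMeasure μ) (hE : G.IsSubgamePayoff μ u E)
    (hu_bdd : ∀ i : N, ∃ C : ℝ, ∀ p : G.Play, |u i p| ≤ C)
    (hu_cont : ∀ i : N, Continuous (u i)) (σ : G.Profile) (s : S) (i : N) (c ε : ℝ)
    (h : ∀ p ∈ G.through s, |u i p - c| ≤ ε) : |E σ s i - c| ≤ ε := by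
  have := hμ.1
  obtain ⟨C, hC⟩ := hu_bdd i
  obtain ⟨ρ, h1, h2⟩ := exists_reach_pos hμ σ s
  have e1 := hE σ ρ s i h1
  have hpos : 0 < (μ ρ (G.through s)).toReal := ENNReal.toReal_pos h2 (measure_ne_top _ _)
  have hint := u_integrable hμ ρ i C hC (hu_cont i)
  have e2 : ∫ p in G.through s, (u i p - c) ∂(μ ρ)
      = (E σ s i - c) * (μ ρ (G.through s)).toReal := by
    rw [integral_sub hint.integrableOn (integrable_const c), e1, setIntegral_const, smul_eq_mul,
      Measure.real]
    ring
  have e3 := norm_setIntegral_le_of_norm_le_const (μ := μ ρ) (s := G.through s)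
    (f := fun p => u i p - c) (C := ε) (measure_lt_top _ _) h
  rw [e2, Real.norm_eq_abs, abs_mul, abs_of_pos hpos] at e3
  exact le_of_mul_le_mul_right e3 hpos

/-- one-step decomposition -/
lemma E_step [Countable S] (hμ : G.IsInducedMeasure μ) (hE : G.IsSubgamePayoff μ u E)
    (hu_bdd : ∀ i : N, ∃ C : ℝ, ∀ p : G.Play, |u i p| ≤ C)
    (hu_cont : ∀ i : N, Continuous (u i)) (σ : G.Profile) (s : S) (i : N) :
    E σ s i = ∑' z, (G.q s (G.playFun σ s) z).toReal * E σ z i := by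
  have := hμ.1
  obtain ⟨C, hC⟩ := hu_bdd i
  obtain ⟨ρ, h1, h2⟩ := exists_reach_pos hμ σ s
  have e1 := hE σ ρ s i h1
  have hpos : 0 < (μ ρ (G.through s)).toReal := ENNReal.toReal_pos h2 (measure_ne_top _ _)
  have hint := u_integrable hμ ρ i C hC (hu_cont i)
  have hs : G.playFun ρ s = G.playFun σ s := h1 s .refl
  set a := G.playFun σ s with ha
  have hact : a ∈ G.act s := G.playFun_mem σ s
  let U : S → Set G.Play := fun z => {p | z ∈ (G.q s a).support ∧ p ∈ G.through z}
  have hUm : ∀ z, MeasurableSet (U z) := fun z => by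
    by_cases hz : z ∈ (G.q s a).support
    · have : U z = G.through z := by ext p; simp [U, (PMF.mem_support_iff _ _).1 hz]
      rw [this]; exact G.measurable_through z
    · have : U z = ∅ := by
        ext p; simp only [U, Set.mem_ofPred_eq, Set.mem_empty_iff_false, iff_false]
        exact fun h => hz h.1
      rw [this]; exact MeasurableSet.empty
  have hUd : Pairwise (Function.onFun Disjoint U) := by
    intro z z' hne
    refine Set.disjoint_left.2 ?_
    rintro p ⟨hz, n, hn⟩ ⟨hz', n', hn'⟩
    obtain ⟨k, rfl, hk⟩ := G.play_pred p n s a hact (hn ▸ hz)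
    obtain ⟨k', rfl, hk'⟩ := G.play_pred p n' s a hact (hn' ▸ hz')
    obtain ⟨rfl, -⟩ := G.play_unique p p k k' (by rw [hk, hk'])
    exact hne (hn.symm.trans hn')
  have hUU : G.takes s a = ⋃ z, U z := by
    ext p
    simp only [Set.mem_iUnion]
    constructor
    · rintro ⟨n, hn⟩
      refine ⟨(p.1 (n + 1)).1, ?_, n + 1, rfl⟩
      have := (p.2.2 n).2
      rwa [hn] at this
    · rintro ⟨z, hz, n, hn⟩
      obtain ⟨k, rfl, hk⟩ := G.play_pred p n s a hact (hn ▸ hz)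
      exact ⟨k, hk⟩
  have hae := through_ae_takes hμ ρ s
  rw [hs] at hae
  rw [setIntegral_congr_set hae, hUU, integral_iUnion hUm hUd hint.integrableOn] at e1
  have e2 : ∀ z, ∫ p in U z, u i p ∂(μ ρ)
      = ((G.q s a z).toReal * E σ z i) * (μ ρ (G.through s)).toReal := by
    intro z
    by_cases hz : z ∈ (G.q s a).support
    · have : U z = G.through z := by ext p; simp [U, (PMF.mem_support_iff _ _).1 hz]
      rw [this, hE σ ρ z i (fun w hw => h1 w (Relation.ReflTransGen.head ⟨a, hact, hz⟩ hw)),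
        measure_through_succ hμ ρ s z (by rw [hs]; exact hz), hs, ENNReal.toReal_mul]
      ring
    · have : U z = ∅ := by
        ext p; simp only [U, Set.mem_ofPred_eq, Set.mem_empty_iff_false, iff_false]
        exact fun h => hz h.1
      rw [PMF.mem_support_iff, not_not] at hz
      rw [this, hz]; simp
  simp only [e2] at e1
  rw [tsum_mul_right] at e1
  exact (mul_right_cancel₀ hpos.ne' e1).symm

lemma E_conv (hμ : G.IsInducedMeasure μ) (hE : G.IsSubgamePayoff μ u E)
    (hu_bdd : ∀ i : N, ∃ C : ℝ, ∀ p : G.Play, |u i p| ≤ C)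
    (hu_cont : ∀ i : N, Continuous (u i)) (i : N) (p : G.Play) (ε : ℝ) (hε : 0 < ε) :
    ∃ n, ∀ k, n ≤ k → ∀ σ, |E σ (p.1 k).1 i - u i p| ≤ ε := by
  obtain ⟨n, hn⟩ := G.exists_cyl_subset p (u i ⁻¹' (Metric.ball (u i p) ε))
    (Metric.isOpen_ball.preimage (hu_cont i)) (by simp [hε])
  refine ⟨n, fun k hk σ => E_bound hμ hE hu_bdd hu_cont σ _ i _ _ ?_⟩
  rintro p' ⟨m, hm⟩
  obtain ⟨rfl, h⟩ := G.play_unique p' p m k hm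
  have : p' ∈ G.cylSet p n := fun j hj => h j (by omega)
  have := hn this
  rw [Set.mem_preimage, Metric.mem_ball, Real.dist_eq] at this
  exact this.le

end Pay
end PGame
namespace PGame

section Val

variable {N S A : Type*} {G : PGame N S A}

/-- The facts about subgame payoffs of player `i` used from here on. -/
structure EGood (G : PGame N S A) (E : G.Profile → S → N → ℝ) (i : N) (C : ℝ)
    (v : G.Play → ℝ) : Prop where
  loc : ∀ (σ σ' : G.Profile) (s : S),
    (∀ z, Relation.ReflTransGen G.step s z → G.playFun σ z = G.playFun σ' z) →
    E σ s i = E σ' s i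
  bd : ∀ σ s, |E σ s i| ≤ C
  st : ∀ σ s, E σ s i = ∑' z, (G.q s (G.playFun σ s) z).toReal * E σ z i
  conv : ∀ (p : G.Play) (ε : ℝ), 0 < ε →
    ∃ n, ∀ k, n ≤ k → ∀ σ, |E σ (p.1 k).1 i - v p| ≤ ε

/-- Good restricted action sets. -/
structure BGood (G : PGame N S A) (B : S → Set A) : Prop where
  sub : ∀ s, B s ⊆ (G.act s : Set A)
  ne : ∀ s, (B s).Nonempty

/-- Admissible strategies of player `i` from `s`. -/
def AdmI (G : PGame N S A) (B : S → Set A) (s : S) (i : N) (f : G.Strat i) : Prop :=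
  ∀ z, Relation.ReflTransGen (G.stepIn B) s z → G.ctrl z = i → f.1 z ∈ B z

/-- Admissible opponent profiles from `s`. -/
def AdmO (G : PGame N S A) (B : S → Set A) (s : S) (i : N) (g : G.Profile) : Prop :=
  ∀ z, Relation.ReflTransGen (G.stepIn B) s z → G.ctrl z ≠ i → G.playFun g z ∈ B z

variable {E : G.Profile → S → N → ℝ} {i : N} {C : ℝ} {v : G.Play → ℝ} {B : S → Set A}

lemma BGood.reach (hB : BGood G B) {z w : S} (h : Relation.ReflTransGen (G.stepIn B) z w) :
    Relation.ReflTransGen G.step z w := by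
  induction h with
  | refl => exact .refl
  | tail _ hbc ih =>
    obtain ⟨c, hc, hy⟩ := hbc
    exact ih.tail ⟨c, hB.sub _ hc, hy⟩

lemma BGood.exists_profile (hB : BGood G B) : ∃ g : G.Profile, ∀ z, G.playFun g z ∈ B z := by
  choose b hb using hB.ne
  exact ⟨G.ofFun b (fun s => hB.sub s (hb s)), hb⟩

lemma BGood.exists_strat (hB : BGood G B) (i : N) : ∃ f : G.Strat i, ∀ z, f.1 z ∈ B z := by
  choose b hb using hB.ne
  exact ⟨⟨b, fun s _ => hB.sub s (hb s)⟩, hb⟩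

lemma BGood.nonemptyI (hB : BGood G B) (s : S) (i : N) :
    Nonempty { f : G.Strat i //
      ∀ z, Relation.ReflTransGen (G.stepIn B) s z → G.ctrl z = i → f.1 z ∈ B z } := by
  obtain ⟨f, hf⟩ := hB.exists_strat i
  exact ⟨⟨f, fun z _ _ => hf z⟩⟩

lemma BGood.nonemptyO (hB : BGood G B) (s : S) (i : N) :
    Nonempty { g : G.Profile //
      ∀ z, Relation.ReflTransGen (G.stepIn B) s z → G.ctrl z ≠ i → G.playFun g z ∈ B z } := by
  obtain ⟨f, hf⟩ := hB.exists_profile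
  exact ⟨⟨f, fun z _ _ => hf z⟩⟩

/-- If player `i` can guarantee `c`, the value is at least `c`. -/
lemma le_rval (hE : EGood G E i C v) (hB : BGood G B) (s : S) (c : ℝ) (f : G.Strat i)
    (hf : AdmI G B s i f) (h : ∀ g, AdmO G B s i g → c ≤ E (G.comb i f g) s i) :
    c ≤ G.rval E B s i := by
  have := hB.nonemptyO s i
  unfold rval
  refine le_ciSup_of_le ⟨C, ?_⟩ ⟨f, hf⟩ (le_ciInf fun g => h g.1 g.2)
  rintro _ ⟨f', rfl⟩
  have g0 := Classical.choice this
  refine ciInf_le_of_le ⟨-C, ?_⟩ g0 (abs_le.1 (hE.bd _ _)).2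
  rintro _ ⟨g, rfl⟩
  exact (abs_le.1 (hE.bd _ _)).1

/-- If the opponents have a reply to each strategy, the value is at most `c`. -/
lemma rval_le (hE : EGood G E i C v) (hB : BGood G B) (s : S) (c : ℝ)
    (h : ∀ f, AdmI G B s i f → ∃ g, AdmO G B s i g ∧ E (G.comb i f g) s i ≤ c) :
    G.rval E B s i ≤ c := by
  have := hB.nonemptyI s i
  unfold rval
  refine ciSup_le fun f => ?_
  obtain ⟨g, hg, hle⟩ := h f.1 f.2
  refine ciInf_le_of_le ⟨-C, ?_⟩ ⟨g, hg⟩ hle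
  rintro _ ⟨g, rfl⟩
  exact (abs_le.1 (hE.bd _ _)).1

lemma exists_opt_strat (hE : EGood G E i C v) (hB : BGood G B) (s : S) (ε : ℝ) (hε : 0 < ε) :
    ∃ f, AdmI G B s i f ∧ ∀ g, AdmO G B s i g → G.rval E B s i ≤ E (G.comb i f g) s i + ε := by
  by_contra! hcon
  have := rval_le hE hB s (G.rval E B s i - ε) (fun f hf => by
    obtain ⟨g, hg, hlt⟩ := hcon f hf
    exact ⟨g, hg, by linarith⟩)
  linarith

lemma exists_reply (hE : EGood G E i C v) (hB : BGood G B) (s : S) (ε : ℝ) (hε : 0 < ε)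
    (f : G.Strat i) (hf : AdmI G B s i f) :
    ∃ g, AdmO G B s i g ∧ E (G.comb i f g) s i ≤ G.rval E B s i + ε := by
  by_contra! hcon
  have := le_rval hE hB s (G.rval E B s i + ε) f hf (fun g hg => (hcon g hg).le)
  linarith

lemma rval_near (hE : EGood G E i C v) (hB : BGood G B) (s : S) (c ε : ℝ)
    (h : ∀ σ, |E σ s i - c| ≤ ε) : |G.rval E B s i - c| ≤ ε := by
  obtain ⟨f, hf⟩ := hB.exists_strat i
  obtain ⟨g, hg⟩ := hB.exists_profile
  rw [abs_le]
  constructor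
  · have := le_rval hE hB s (c - ε) f (fun z _ _ => hf z)
      (fun g _ => by linarith [(abs_le.1 (h (G.comb i f g))).1])
    linarith
  · have := rval_le hE hB s (c + ε)
      (fun f _ => ⟨g, fun z _ _ => hg z, by linarith [(abs_le.1 (h (G.comb i f g))).2]⟩)
    linarith

lemma rval_bd (hE : EGood G E i C v) (hB : BGood G B) (s : S) : |G.rval E B s i| ≤ C := by
  simpa using rval_near hE hB s 0 C (by simpa using fun σ => hE.bd σ s)

/-- Upper dynamic programming inequality. -/
lemma rval_le_rvalQ_aux (hE : EGood G E i C v) (hB : BGood G B) (s : S) (f : G.Strat i)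
    (hf : AdmI G B s i f) (a : A) (ha : a ∈ B s) (hfa : G.ctrl s = i → f.1 s = a)
    (ε : ℝ) (hε : 0 < ε) :
    ∃ g, AdmO G B s i g ∧ E (G.comb i f g) s i ≤ G.rvalQ E B s a i + ε := by
  obtain ⟨g0, hg0⟩ := hB.exists_profile
  have hch : ∀ z, ∃ g, AdmO G B z i g ∧
      (AdmI G B z i f → E (G.comb i f g) z i ≤ G.rval E B z i + ε) := by
    intro z
    by_cases h : AdmI G B z i f
    · obtain ⟨g, h1, h2⟩ := exists_reply hE hB z ε hε f h
      exact ⟨g, h1, fun _ => h2⟩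
    · exact ⟨g0, fun w _ _ => hg0 w, fun h' => absurd h' h⟩
  choose gz hgz1 hgz2 using hch
  obtain ⟨F, hF, hFs, hFz⟩ := G.exists_paste s a (hB.sub s ha) (fun z => G.playFun (gz z))
    (fun z w => G.playFun_mem _ w)
  refine ⟨G.ofFun F hF, ?_, ?_⟩
  · intro w hw hwi
    show F w ∈ B w
    rcases Relation.ReflTransGen.cases_head hw with rfl | ⟨z, ⟨a', ha', hz⟩, hzw⟩
    · rw [hFs]; exact ha
    · rw [hFz z ⟨a', hB.sub s ha', hz⟩ w
        (hB.reach hzw)]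
      exact hgz1 z w hzw hwi
  · have hplay : G.playFun (G.comb i f (G.ofFun F hF)) s = a := by
      by_cases h : G.ctrl s = i
      · rw [G.playFun_comb_self i f _ s h, hfa h]
      · rw [G.playFun_comb_ne i f _ s h]; exact hFs
    rw [hE.st, hplay]
    refine aux_mono _ _ _ C C (fun z => hE.bd _ _) (fun z => rval_bd hE hB z) ε ?_
    intro z hz
    have hadm : AdmI G B z i f := fun w hw => hf w (Relation.ReflTransGen.head ⟨a, ha, hz⟩ hw)
    refine le_trans (le_of_eq ?_) (hgz2 z hadm)
    refine hE.loc _ _ _ fun w hw => ?_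
    by_cases h : G.ctrl w = i
    · rw [G.playFun_comb_self i f _ w h, G.playFun_comb_self i f _ w h]
    · rw [G.playFun_comb_ne i f _ w h, G.playFun_comb_ne i f _ w h]
      exact hFz z ⟨a, hB.sub s ha, hz⟩ w hw

lemma rval_le_rvalQ_opp (hE : EGood G E i C v) (hB : BGood G B) (s : S) (a : A) (ha : a ∈ B s)
    (hs : G.ctrl s ≠ i) : G.rval E B s i ≤ G.rvalQ E B s a i := by
  refine le_of_forall_pos_le_add fun ε hε => ?_
  exact rval_le hE hB s _ fun f hf =>
    rval_le_rvalQ_aux hE hB s f hf a ha (fun h => absurd h hs) ε hε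

lemma exists_rval_le_rvalQ (hE : EGood G E i C v) (hB : BGood G B) (s : S)
    (hs : G.ctrl s = i) : ∃ a ∈ B s, G.rval E B s i ≤ G.rvalQ E B s a i := by
  have hfin : (B s).Finite := (G.act s).finite_toSet.subset (hB.sub s)
  obtain ⟨a, ha, hmax⟩ := hfin.exists_maximalFor (fun a => G.rvalQ E B s a i) _ (hB.ne s)
  refine ⟨a, ha, le_of_forall_pos_le_add fun ε hε => ?_⟩
  refine rval_le hE hB s _ fun f hf => ?_
  have hfs : f.1 s ∈ B s := hf s .refl hs
  obtain ⟨g, hg, hle⟩ := rval_le_rvalQ_aux hE hB s f hf (f.1 s) hfs (fun _ => rfl) ε hε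
  refine ⟨g, hg, hle.trans ?_⟩
  have : G.rvalQ E B s (f.1 s) i ≤ G.rvalQ E B s a i := by
    rcases le_total (G.rvalQ E B s (f.1 s) i) (G.rvalQ E B s a i) with h | h
    · exact h
    · exact hmax hfs h
  linarith

/-- Lower dynamic programming inequality. -/
lemma rvalQ_le_rval (hE : EGood G E i C v) (hB : BGood G B) (s : S) (hs : G.ctrl s = i)
    (a : A) (ha : a ∈ B s) : G.rvalQ E B s a i ≤ G.rval E B s i := by
  refine le_of_forall_pos_le_add fun ε hε => ?_
  rw [← sub_le_iff_le_add]
  obtain ⟨g0, hg0⟩ := hB.exists_profile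
  choose fz hfz1 hfz2 using fun z => exists_opt_strat hE hB z ε hε
  obtain ⟨F, hF, hFs, hFz⟩ := G.exists_paste s a (hB.sub s ha)
    (fun z => G.playFun (G.comb i (fz z) g0)) (fun z w => G.playFun_mem _ w)
  obtain ⟨f, hfF⟩ : ∃ f : G.Strat i, f.1 = F := ⟨⟨F, fun w _ => hF w⟩, rfl⟩
  refine le_rval hE hB s _ f ?_ ?_
  · intro w hw hwi
    rw [hfF]
    rcases Relation.ReflTransGen.cases_head hw with rfl | ⟨z, ⟨a', ha', hz⟩, hzw⟩
    · rw [hFs]; exact ha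
    · rw [hFz z ⟨a', hB.sub s ha', hz⟩ w
        (hB.reach hzw), G.playFun_comb_self _ _ _ _ hwi]
      exact hfz1 z w hzw hwi
  · intro g hg
    rw [sub_le_iff_le_add, hE.st, G.playFun_comb_self _ _ _ _ hs]
    rw [hfF, hFs]
    refine aux_mono _ _ _ C C (fun z => rval_bd hE hB z) (fun z => hE.bd _ _) ε ?_
    intro z hz
    have hadm : AdmO G B z i g := fun w hw => hg w (Relation.ReflTransGen.head ⟨a, ha, hz⟩ hw)
    refine (hfz2 z g hadm).trans (le_of_eq ?_)
    congr 1
    refine hE.loc _ _ _ fun w hw => ?_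
    by_cases h : G.ctrl w = i
    · rw [G.playFun_comb_self _ _ _ w h, G.playFun_comb_self _ _ _ w h]
      rw [hfF, hFz z ⟨a, hB.sub s ha, hz⟩ w hw, G.playFun_comb_self _ _ _ w h]
    · rw [G.playFun_comb_ne _ _ _ w h, G.playFun_comb_ne _ _ _ w h]

/-- Submartingale argument: if the value does not decrease along `σ`, then `σ` yields at least
the value. -/
lemma rval_le_E (hE : EGood G E i C v) (hB : BGood G B) (σ : G.Profile) (R : S → Prop)
    (hR : ∀ z, R z → ∀ z' ∈ (G.q z (G.playFun σ z)).support, R z')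
    (hsub : ∀ z, R z → G.rval E B z i ≤ G.rvalQ E B z (G.playFun σ z) i)
    (s : S) (hs : R s) : G.rval E B s i ≤ E σ s i := by
  by_contra! hlt
  set D : S → ℝ := fun z => E σ z i - G.rval E B z i with hD
  have hDb : ∀ z, |D z| ≤ C + C := fun z =>
    (abs_sub _ _).trans (add_le_add (hE.bd _ _) (rval_bd hE hB z))
  have hstep : ∀ z, ∃ z' ∈ (G.q z (G.playFun σ z)).support, R z → D z' ≤ D z := by
    intro z
    by_cases hz : R z
    · obtain ⟨z', h1, h2⟩ := aux_exists_le (G.q z (G.playFun σ z)) D (C + C) hDb (D z) (by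
        have := hsub z hz
        simp only [hD, mul_sub]
        rw [(aux_summable _ _ C (fun z => hE.bd σ z)).tsum_sub
          (aux_summable _ _ C (fun z => rval_bd hE hB z)), ← hE.st]
        unfold rvalQ at this
        linarith)
      exact ⟨z', h1, fun _ => h2⟩
    · obtain ⟨z', h⟩ := (G.q z (G.playFun σ z)).support_nonempty
      exact ⟨z', h, fun h => absurd h hz⟩
  choose nx hnx hnxD using hstep
  have hinv : ∀ m, R (nx^[m] s) ∧ D (nx^[m] s) ≤ D s := by
    intro m
    induction m with
    | zero => exact ⟨hs, le_rfl⟩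
    | succ m ih =>
      rw [Function.iterate_succ_apply']
      exact ⟨hR _ ih.1 _ (hnx _), (hnxD _ ih.1).trans ih.2⟩
  obtain ⟨n, p, hp⟩ := G.exists_play_tail s _ rfl
    (G.legal_iter (G.playFun σ) nx (G.playFun_mem σ) hnx s)
  have hDs : D s < 0 := by simp only [hD]; linarith
  obtain ⟨k, hk⟩ := hE.conv p (-D s / 3) (by linarith)
  have h1 := hk (n + k) (by omega)
  have h2 := rval_near hE hB _ _ _ h1
  have h3 := h1 σ
  have h4 := (hinv k).2
  rw [hp k] at h2 h3
  simp only at h2 h3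
  rw [abs_le] at h2 h3
  simp only [hD] at h2 h3 h4 hDs
  linarith [h2.1, h2.2, h3.1, h3.2]

/-- Elimination facts. -/
lemma Ak_succ (k : ℕ) (s : S) : G.Ak E (k + 1) s =
    { a ∈ G.Ak E k s | G.rvalQ E (G.Ak E k) s a (G.ctrl s) =
      G.rval E (G.Ak E k) s (G.ctrl s) } := rfl

lemma Ak_good {Cf : N → ℝ} {vf : N → G.Play → ℝ} (hE : ∀ i, EGood G E i (Cf i) (vf i)) (k : ℕ) :
    BGood G (G.Ak E k) := by
  induction k with
  | zero => exact ⟨fun s => subset_rfl, fun s => G.act_nonempty s⟩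
  | succ k ih =>
    refine ⟨fun s a ha => ih.sub s ha.1, fun s => ?_⟩
    obtain ⟨a, ha, h⟩ := exists_rval_le_rvalQ (hE (G.ctrl s)) ih s rfl
    exact ⟨a, ha, le_antisymm (rvalQ_le_rval (hE _) ih s rfl a ha) h⟩

/-- Along actions of `A^{k+1}`, all values `v^k` do not decrease. -/
lemma Ak_submart {Cf : N → ℝ} {vf : N → G.Play → ℝ} (hE : ∀ i, EGood G E i (Cf i) (vf i))
    (k : ℕ) (i : N) (z : S) (a : A) (ha : a ∈ G.Ak E (k + 1) z) :
    G.rval E (G.Ak E k) z i ≤ G.rvalQ E (G.Ak E k) z a i := by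
  by_cases h : G.ctrl z = i
  · subst h
    exact ha.2.ge
  · exact rval_le_rvalQ_opp (hE i) (Ak_good hE k) z a ha.1 h

lemma rval_mono {Cf : N → ℝ} {vf : N → G.Play → ℝ} (hE : ∀ i, EGood G E i (Cf i) (vf i))
    (k : ℕ) (i : N) (s : S) :
    G.rval E (G.Ak E k) s i ≤ G.rval E (G.Ak E (k + 1)) s i := by
  have hB := Ak_good hE (k + 1)
  obtain ⟨f, hf⟩ := hB.exists_strat i
  refine le_rval (hE i) hB s _ f (fun z _ _ => hf z) fun g hg => ?_
  have hact : ∀ z, Relation.ReflTransGen (G.stepIn (G.Ak E (k + 1))) s z →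
      G.playFun (G.comb i f g) z ∈ G.Ak E (k + 1) z := by
    intro z hz
    by_cases h : G.ctrl z = i
    · rw [G.playFun_comb_self _ _ _ _ h]; exact hf z
    · rw [G.playFun_comb_ne _ _ _ _ h]; exact hg z hz h
  exact rval_le_E (hE i) (Ak_good hE k) _
    (fun z => Relation.ReflTransGen (G.stepIn (G.Ak E (k + 1))) s z)
    (fun z hz z' hz' => hz.tail ⟨_, hact z hz, hz'⟩)
    (fun z hz => Ak_submart hE k i z _ (hact z hz)) s .refl

lemma rval_mono_zero {Cf : N → ℝ} {vf : N → G.Play → ℝ} (hE : ∀ i, EGood G E i (Cf i) (vf i))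
    (k : ℕ) (i : N) (s : S) :
    G.rval E (G.Ak E 0) s i ≤ G.rval E (G.Ak E k) s i := by
  induction k with
  | zero => exact le_rfl
  | succ k ih => exact ih.trans (rval_mono hE k i s)

lemma Ak_sub (k : ℕ) (s : S) : G.Ak E k s ⊆ (G.act s : Set A) := by
  induction k with
  | zero => exact subset_rfl
  | succ k ih => exact fun a ha => ih ha.1

lemma Sk_pred (k : ℕ) (s z : S) (a : A) (ha : a ∈ G.act s) (hz : z ∈ (G.q s a).support)
    (h : z ∈ G.Sk E k) : s ∈ G.Sk E k ∧ a ∈ G.Ak E k s := by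
  rcases Relation.ReflTransGen.cases_tail h with rfl | ⟨c, hc, b, hb, hbz⟩
  · exact absurd hz (G.init_not_succ s a ha)
  · obtain ⟨rfl, rfl⟩ := G.unique_pred z c b s a (Ak_sub k c hb) ha hbz hz
    exact ⟨hc, hb⟩

lemma Sinf_pred (s z : S) (a : A) (ha : a ∈ G.act s) (hz : z ∈ (G.q s a).support)
    (h : z ∈ G.Sinf E) : s ∈ G.Sinf E ∧ a ∈ G.Ainf E s := by
  simp only [Sinf, Ainf, Set.mem_iInter] at h ⊢
  exact ⟨fun k => (Sk_pred k s z a ha hz (h k)).1, fun k => (Sk_pred k s z a ha hz (h k)).2⟩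

lemma Sinf_succ (s z : S) (a : A) (hs : s ∈ G.Sinf E) (ha : a ∈ G.Ainf E s)
    (hz : z ∈ (G.q s a).support) : z ∈ G.Sinf E := by
  simp only [Sinf, Ainf, Set.mem_iInter] at hs ha ⊢
  exact fun k => Relation.ReflTransGen.tail (hs k) ⟨a, ha k, hz⟩

lemma exists_elim_stage (s : S) (a : A) (ha : a ∈ G.act s) (hn : a ∉ G.Ainf E s) :
    ∃ k, a ∈ G.Ak E k s ∧ a ∉ G.Ak E (k + 1) s := by
  by_contra! hcon
  refine hn (Set.mem_iInter.2 fun k => ?_)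
  induction k with
  | zero => exact ha
  | succ k ih => exact hcon k ih

end Val
end PGame

/-- **Deviating outside `G^∞` is strictly worse** (Lemma 6): with the punishment
profile `τ` built from `ρ*`, `L`, `σ_{-i}` and `σ^∞_{-i}`, for every player `i`,
every strategy `τ'_i` of player `i` and every state `s ∈ S^∞` controlled by `i`
with `L(s) ∈ {⊥, i}` and `τ'_i(s) ∈ A(s) ∖ A^∞(s)`, one has
`u_i(τ'_i, τ_{-i} | s) < u_i(τ | s)`. -/
theorem deviation_outside_limit_game_strictly_worse
    {N S A : Type*} [Fintype N] [DecidableEq N] [Countable S]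
    (hN : 2 ≤ Fintype.card N)
    (G : PGame N S A) (u : N → G.Play → ℝ)
    (hu_bdd : ∀ i : N, ∃ C : ℝ, ∀ p : G.Play, |u i p| ≤ C)
    (hu_cont : ∀ i : N, Continuous (u i))
    (μ : G.Profile → MeasureTheory.Measure G.Play)
    (hμ : G.IsInducedMeasure μ)
    (E : G.Profile → S → N → ℝ)
    (hE : G.IsSubgamePayoff μ u E)
    -- for every player `i`, `σm i` is an opponent profile `σ_{-i}` that punishes
    -- player `i` down to the value `v_i(s)` in every subgame `G(s)`
    (σm : N → G.Profile)
    (hσm : ∀ (i : N) (s : S) (τi : G.Strat i),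
        E (G.comb i τi (σm i)) s i ≤ G.rval E (G.Ak E 0) s i)
    -- for every player `i`, `σinf i` is an opponent profile `σ^∞_{-i}` playing only
    -- actions of `G^∞`, punishing player `i` down to `v^∞_i(s)` in every subgame of
    -- `G^∞`
    (σinf : N → G.Profile)
    (hσinf_in : ∀ (i j : N) (s : S), s ∈ G.Sinf E → j ≠ i → G.ctrl s = j →
        ((σinf i) j).1 s ∈ G.Ainf E s)
    (hσinf : ∀ (i : N), ∀ s ∈ G.Sinf E, ∀ τi : G.Strat i,
        (∀ z ∈ G.Sinf E, G.ctrl z = i → τi.1 z ∈ G.Ainf E z) →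
        E (G.comb i τi (σinf i)) s i ≤ G.rval E (G.Ainf E) s i)
    -- `ρ` is a strategy profile `ρ*` of `G^∞` minimizing the sum of the expected
    -- payoffs of all players over all strategy profiles of `G^∞`
    (ρ : G.Profile)
    (hρ_in : ∀ s ∈ G.Sinf E, G.playFun ρ s ∈ G.Ainf E s)
    (hρ_min : ∀ ρ' : G.Profile, (∀ s ∈ G.Sinf E, G.playFun ρ' s ∈ G.Ainf E s) →
        ∑ i : N, G.epay μ u ρ i ≤ ∑ i : N, G.epay μ u ρ' i)
    -- `L` records the first player who deviated from `ρ*` (`none` = `⊥`, nobody)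
    (L : S → Option N)
    (hL_init : L G.init = none)
    (hL : ∀ (s : S) (a : A), a ∈ G.act s → ∀ z ∈ (G.q s a).support,
        (L s = none → G.playFun ρ s = a → L z = none) ∧
        (L s = none → G.playFun ρ s ≠ a → L z = some (G.ctrl s)) ∧
        (L s ≠ none → L z = L s))
    -- `τ` is the punishment profile: follow `ρ*` as long as nobody deviated; once
    -- player `i` has deviated, punish him with `σ^∞_{-i}` inside `S^∞` and with
    -- `σ_{-i}` outside `S^∞` (the deviator himself plays inside `A^∞` on `S^∞`)
    (τ : G.Profile)
    (hτ_follow : ∀ s : S, L s = none → G.playFun τ s = G.playFun ρ s)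
    (hτ_dev : ∀ s : S, L s = some (G.ctrl s) → s ∈ G.Sinf E →
        G.playFun τ s ∈ G.Ainf E s)
    (hτ_pun_inf : ∀ (s : S) (i : N), L s = some i → i ≠ G.ctrl s → s ∈ G.Sinf E →
        G.playFun τ s = G.playFun (σinf i) s)
    (hτ_pun_out : ∀ (s : S) (i : N), L s = some i → i ≠ G.ctrl s → s ∉ G.Sinf E →
        G.playFun τ s = G.playFun (σm i) s) :
    ∀ (i : N) (τ'i : G.Strat i) (s : S), s ∈ G.Sinf E → G.ctrl s = i →
      (L s = none ∨ L s = some i) → τ'i.1 s ∉ G.Ainf E s →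
      E (G.comb i τ'i τ) s i < E τ s i := by
  choose Cf hCf using fun i => hu_bdd i
  have hG : ∀ i, PGame.EGood G E i (Cf i) (u i) := fun i =>
    { loc := fun σ σ' s h => PGame.E_local hμ hE σ σ' s i h
      bd := fun σ s => by
        simpa using PGame.E_bound hμ hE hu_bdd hu_cont σ s i 0 (Cf i)
          (by simpa using fun p _ => hCf i p)
      st := fun σ s => PGame.E_step hμ hE hu_bdd hu_cont σ s i
      conv := PGame.E_conv hμ hE hu_bdd hu_cont i }
  intro i τ'i s hs hctrl hLs hout
  have ha : τ'i.1 s ∈ G.act s := τ'i.2 s hctrl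
  set a := τ'i.1 s with ha_def
  obtain ⟨k, hk, hk'⟩ := PGame.exists_elim_stage s a ha hout
  have hB := PGame.Ak_good hG k
  -- following `τ` gives at least `v^k`
  have hτ_in : ∀ z, z ∈ G.Sinf E → (L z = none ∨ L z = some i) → G.playFun τ z ∈ G.Ainf E z := by
    rintro z hz (hL0 | hL1)
    · rw [hτ_follow z hL0]; exact hρ_in z hz
    · by_cases hc : G.ctrl z = i
      · exact hτ_dev z (hc ▸ hL1) hz
      · rw [hτ_pun_inf z i hL1 (Ne.symm hc) hz]
        exact hσinf_in i (G.ctrl z) z hz hc rfl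
  have hlow : G.rval E (G.Ak E k) s i ≤ E τ s i := by
    refine PGame.rval_le_E (hG i) hB τ
      (fun z => z ∈ G.Sinf E ∧ (L z = none ∨ L z = some i)) ?_ ?_ s ⟨hs, hLs⟩
    · rintro z ⟨hz, hLz⟩ z' hz'
      refine ⟨PGame.Sinf_succ z z' _ hz (hτ_in z hz hLz) hz', ?_⟩
      have h3 := hL z _ (G.playFun_mem τ z) z' hz'
      rcases hLz with h | h
      · exact Or.inl (h3.1 h (hτ_follow z h).symm)
      · exact Or.inr ((h3.2.2 (by simp [h])).trans h)
    · rintro z ⟨hz, hLz⟩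
      exact PGame.Ak_submart hG k i z _ (Set.mem_iInter.1 (hτ_in z hz hLz) (k + 1))
  -- the eliminated action is strictly worse at stage `k`
  have hstrict : G.rvalQ E (G.Ak E k) s a i < G.rval E (G.Ak E k) s i := by
    refine lt_of_le_of_ne (PGame.rvalQ_le_rval (hG i) hB s hctrl a hk) fun h => hk' ⟨hk, ?_⟩
    rw [hctrl]; exact h
  -- after the deviation the opponents punish down to `v^0`
  have hup : E (G.comb i τ'i τ) s i ≤ G.rvalQ E (G.Ak E k) s a i + 0 := by
    rw [(hG i).st, G.playFun_comb_self _ _ _ _ hctrl]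
    refine PGame.aux_mono _ _ _ (Cf i) (Cf i) (fun z => (hG i).bd _ _)
      (fun z => PGame.rval_bd (hG i) hB z) 0 ?_
    intro z hz
    have hz0 : z ∉ G.Sinf E ∧ L z = some i := by
      refine ⟨fun h => hout (PGame.Sinf_pred s z a ha hz h).2, ?_⟩
      have h3 := hL s a ha z hz
      rcases hLs with h | h
      · rw [← hctrl]
        refine h3.2.1 h fun he => hout ?_
        rw [← he]; exact hρ_in s hs
      · exact (h3.2.2 (by simp [h])).trans h
    have hsubtree : ∀ w, Relation.ReflTransGen G.step z w → w ∉ G.Sinf E ∧ L w = some i := by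
      intro w hw
      induction hw with
      | refl => exact hz0
      | @tail b c _ hbc ih =>
        obtain ⟨d, hd, hc⟩ := hbc
        exact ⟨fun h => ih.1 (PGame.Sinf_pred b c d hd hc h).1,
          ((hL b d hd c hc).2.2 (by simp [ih.2])).trans ih.2⟩
    have heq : E (G.comb i τ'i τ) z i = E (G.comb i τ'i (σm i)) z i := by
      refine (hG i).loc _ _ _ fun w hw => ?_
      by_cases h : G.ctrl w = i
      · rw [G.playFun_comb_self _ _ _ w h, G.playFun_comb_self _ _ _ w h]
      · rw [G.playFun_comb_ne _ _ _ w h, G.playFun_comb_ne _ _ _ w h]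
        exact hτ_pun_out w i (hsubtree w hw).2 (Ne.symm h) (hsubtree w hw).1
    rw [heq, add_zero]
    exact (hσm i z τ'i).trans (PGame.rval_mono_zero hG k i z)
  linarith
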